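/- Fix, for each buyer i ∈ [n], two XOS valuations f_i^1, f_i^2 that are assigned independently and uniformly at random to s_i and r_i. Let p^(i) be the prices faced by buyer i when the modified buyer-wise greedy algorithm is run on the profile s, and let B_i be a demand set of r_i at prices p^(i) over all of [m]. Then E[Σ_{i∈[n]} r_i(B_i)] ≥ (1/3)·E[OPT(s)]. -/

import Mathlib

open scoped BigOperators

/-- A valuation is a real-valued set function on bundles of the `m` items. -/
abbrev Val (m : ℕ) := Finset (Fin m) → ℝ

/-- A (normalized, monotone) valuation. -/
def IsValuation {m : ℕ} (v : Val m) : Prop :=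
  v ∅ = 0 ∧ ∀ A B : Finset (Fin m), A ⊆ B → v A ≤ v B

/-- XOS (fractionally subadditive) valuations: a pointwise maximum of finitely many
nonnegative additive functions. -/
def IsXOS {m : ℕ} (v : Val m) : Prop :=
  ∃ (k : ℕ) (a : Fin (k + 1) → Fin m → ℝ),
    (∀ ℓ j, 0 ≤ a ℓ j) ∧ ∀ B : Finset (Fin m), v B = ⨆ ℓ, ∑ j ∈ B, a ℓ j

/-- An allocation: pairwise disjoint bundles. -/
def IsAlloc {n m : ℕ} (A : Fin n → Finset (Fin m)) : Prop :=
  ∀ i i' : Fin n, i ≠ i' → Disjoint (A i) (A i')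

/-- The optimal offline welfare of a valuation profile. -/
noncomputable def OPT {n m : ℕ} (v : Fin n → Val m) : ℝ :=
  ⨆ A : {A : Fin n → Finset (Fin m) // IsAlloc A}, ∑ i, v i (A.1 i)

/-- `B` is a demand set of valuation `v` at prices `p` among the available items `M`:
it maximizes the utility `v(B) - Σ_{j ∈ B} p j` over subsets of `M`. -/
def IsDemand {m : ℕ} (v : Val m) (p : Fin m → ℝ) (M : Finset (Fin m))
    (B : Finset (Fin m)) : Prop :=
  B ⊆ M ∧ ∀ B' ⊆ M, v B' - ∑ j ∈ B', p j ≤ v B - ∑ j ∈ B, p j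

/-- `a` is an additive supporting function of `v` on `B`. -/
def IsSupport {m : ℕ} (v : Val m) (B : Finset (Fin m)) (a : Fin m → ℝ) : Prop :=
  (∀ j, 0 ≤ a j) ∧ (∀ j, j ∉ B → a j = 0) ∧
  (∀ B' : Finset (Fin m), ∑ j ∈ B', a j ≤ v B') ∧ ∑ j ∈ B, a j = v B

/-- The least power of two that is at least `x` (by convention `0` for `x ≤ 0`). -/
noncomputable def pow2ceil (x : ℝ) : ℝ :=
  if x ≤ 0 then 0 else (2 : ℝ) ^ (⌈Real.logb 2 x⌉ : ℤ)

variable {n m : ℕ}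

/-- The sample profile determined by the coin flips `c`: buyer `i`'s sample is
`f1 i` if `c i` and `f2 i` otherwise. -/
def sOf (f1 f2 : Fin n → Val m) (c : Fin n → Bool) : Fin n → Val m :=
  fun i => if c i then f1 i else f2 i

/-- The actual profile determined by the coin flips `c`: buyer `i`'s actual
valuation is the one of `f1 i`, `f2 i` not used as the sample. -/
def rOf (f1 f2 : Fin n → Val m) (c : Fin n → Bool) : Fin n → Val m :=
  fun i => if c i then f2 i else f1 i

theorem le_pow2ceil (x : ℝ) : x ≤ pow2ceil x := by
  unfold pow2ceil
  split_ifs with h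
  · exact h
  · rw [← Real.rpow_intCast, ← Real.logb_le_iff_le_rpow one_lt_two (not_le.mp h)]
    exact Int.le_ceil _

theorem pow2ceil_le_two_mul {x : ℝ} (hx : 0 ≤ x) : pow2ceil x ≤ 2 * x := by
  unfold pow2ceil
  split_ifs with h
  · positivity
  · have hx' : 0 < x := not_le.mp h
    rw [← Real.rpow_intCast, ← Real.le_logb_iff_rpow_le one_lt_two (by positivity),
      Real.logb_mul two_ne_zero hx'.ne', Real.logb_self_eq_one one_lt_two]
    linarith [Int.ceil_lt_add_one (Real.logb 2 x)]

/-- On a demand set, each supporting value is at least the corresponding price. -/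
theorem IsDemand.price_le_support {m : ℕ} {v : Val m} {q : Fin m → ℝ} {A : Finset (Fin m)}
    {a : Fin m → ℝ} (hA : IsDemand v q Finset.univ A) (ha : IsSupport v A a)
    {j : Fin m} (hj : j ∈ A) : q j ≤ a j := by
  have hdem := hA.2 (A.erase j) (Finset.subset_univ _)
  have hsupp := ha.2.2.1 (A.erase j)
  have hval := ha.2.2.2
  rw [← Finset.add_sum_erase A a hj] at hval
  rw [← Finset.add_sum_erase A q hj] at hdem
  linarith

theorem sum_succ_sub_castSucc {n : ℕ} (g : Fin (n + 1) → ℝ) :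
    ∑ i : Fin n, (g i.succ - g i.castSucc) = g (Fin.last n) - g 0 := by
  rw [Finset.sum_sub_distrib]
  linarith [Fin.sum_univ_succ g, Fin.sum_univ_castSucc g]

/-- Bundles assigned by the buyer-wise greedy algorithm with prices rounded up to powers of two
have at least a third of the optimal welfare. -/
theorem OPT_le_three_mul_greedy {n m : ℕ} {v : Fin n → Val m} {q : Fin (n + 1) → Fin m → ℝ}
    {A : Fin n → Finset (Fin m)} {a : Fin n → Fin m → ℝ}
    (hA : ∀ i, IsDemand (v i) (q i.castSucc) Finset.univ (A i))
    (ha : ∀ i, IsSupport (v i) (A i) (a i)) (hq0 : ∀ j, q 0 j = 0)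
    (hq : ∀ i j, q i.succ j = if j ∈ A i then pow2ceil (a i j) else q i.castSucc j) :
    OPT v ≤ 3 * ∑ i, v i (A i) := by
  have hmono : Monotone q := Fin.monotone_iff_le_succ.mpr fun i j => by
    rw [hq]
    split_ifs with h
    · exact ((hA i).price_le_support (ha i) h).trans (le_pow2ceil _)
    · exact le_rfl
  have hnonneg : ∀ i j, 0 ≤ q i j := fun i j => hq0 j ▸ hmono (Fin.zero_le i) j
  have hstep : ∀ i, v i (A i) - ∑ j ∈ A i, q i.castSucc j
      + ∑ j, (q i.succ j - q i.castSucc j) ≤ 3 * v i (A i) := fun i => by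
    have hincr : ∑ j, (q i.succ j - q i.castSucc j)
        = ∑ j ∈ A i, (pow2ceil (a i j) - q i.castSucc j) := by
      rw [← Finset.sum_subset (Finset.subset_univ (A i)) fun j _ hj => by simp [hq, hj]]
      exact Finset.sum_congr rfl fun j hj => by simp [hq, hj]
    rw [hincr, ← (ha i).2.2.2, ← Finset.sum_sub_distrib, ← Finset.sum_add_distrib,
      Finset.mul_sum]
    exact Finset.sum_le_sum fun j _ => by
      linarith [pow2ceil_le_two_mul ((ha i).1 j), hnonneg i.castSucc j]
  have hprices : ∑ i : Fin n, ∑ j, (q i.succ j - q i.castSucc j) = ∑ j, q (Fin.last n) j := by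
    rw [Finset.sum_comm]
    exact Finset.sum_congr rfl fun j _ => by
      rw [sum_succ_sub_castSucc fun i => q i j, hq0, sub_zero]
  have : Nonempty {O : Fin n → Finset (Fin m) // IsAlloc O} :=
    ⟨⟨fun _ => ∅, fun _ _ _ => Finset.disjoint_empty_left _⟩⟩
  refine ciSup_le fun ⟨O, hO⟩ => ?_
  have hdisj : ∑ i, ∑ j ∈ O i, q (Fin.last n) j ≤ ∑ j, q (Fin.last n) j := by
    rw [← Finset.sum_biUnion fun i _ i' _ h => hO i i' h]
    exact Finset.sum_le_sum_of_subset_of_nonneg (Finset.subset_univ _) fun j _ _ => hnonneg _ j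
  have hutil : ∑ i, v i (O i) ≤ ∑ i, (v i (A i) - ∑ j ∈ A i, q i.castSucc j)
      + ∑ i, ∑ j ∈ O i, q (Fin.last n) j := by
    rw [← Finset.sum_add_distrib]
    refine Finset.sum_le_sum fun i _ => ?_
    have hle : ∑ j ∈ O i, q i.castSucc j ≤ ∑ j ∈ O i, q (Fin.last n) j :=
      Finset.sum_le_sum fun j _ => hmono (Fin.le_last _) j
    linarith [(hA i).2 (O i) (Finset.subset_univ _)]
  have htotal := Finset.sum_le_sum fun i (_ : i ∈ Finset.univ) => hstep i
  rw [Finset.sum_add_distrib, hprices, ← Finset.mul_sum] at htotal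
  exact hutil.trans (by linarith)

/-- For each buyer `i`, two XOS valuations `f1 i, f2 i` are assigned
independently and uniformly at random (by the coin flips `c`) to the sample `s i` and
the actual valuation `r i`.  The modified buyer-wise greedy algorithm (demand sets
chosen by the fixed rule `d`, supporting functions by the fixed rule `asup`, and
prices rounded up to powers of two) is run on the sample profile `s`, producing the
prices `p s i` faced by buyer `i`; buyer `i`'s demand set for the actual valuation is
`B i = d (p s i) (r i)`.  Then `E[Σ_i r i (B i)] ≥ (1/3) · E[OPT s]`. -/
theorem stmt5 (f1 f2 : Fin n → Val m)
    (hf1 : ∀ i, IsValuation (f1 i) ∧ IsXOS (f1 i))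
    (hf2 : ∀ i, IsValuation (f2 i) ∧ IsXOS (f2 i))
    (d : (Fin m → ℝ) → Val m → Finset (Fin m))
    (hd : ∀ q v, IsDemand v q Finset.univ (d q v))
    (asup : Val m → Finset (Fin m) → Fin m → ℝ)
    (hsup1 : ∀ i B, IsSupport (f1 i) B (asup (f1 i) B))
    (hsup2 : ∀ i B, IsSupport (f2 i) B (asup (f2 i) B))
    (p : (Fin n → Val m) → Fin (n + 1) → Fin m → ℝ)
    (hp0 : ∀ s j, p s 0 j = 0)
    (hupd : ∀ (c : Fin n → Bool) (i : Fin n) (j : Fin m),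
      p (sOf f1 f2 c) i.succ j =
        if j ∈ d (p (sOf f1 f2 c) i.castSucc) (sOf f1 f2 c i)
        then pow2ceil
          (asup (sOf f1 f2 c i) (d (p (sOf f1 f2 c) i.castSucc) (sOf f1 f2 c i)) j)
        else p (sOf f1 f2 c) i.castSucc j) :
    (Fintype.card (Fin n → Bool) : ℝ)⁻¹ *
        ∑ c : Fin n → Bool, ∑ i : Fin n,
          rOf f1 f2 c i (d (p (sOf f1 f2 c) i.castSucc) (rOf f1 f2 c i)) ≥
      (1 / 3) *
        ((Fintype.card (Fin n → Bool) : ℝ)⁻¹ *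
          ∑ c : Fin n → Bool, OPT (sOf f1 f2 c)) := by
  -- The prices faced by a buyer do not depend on the coin of that buyer.
  have hindep : ∀ (c c' : Fin n → Bool) (k : Fin (n + 1)),
      (∀ i : Fin n, i.castSucc < k → c i = c' i) →
        p (sOf f1 f2 c) k = p (sOf f1 f2 c') k := by
    intro c c' k
    induction k using Fin.induction with
    | zero => intro _; funext j; rw [hp0, hp0]
    | succ i ih =>
      intro h
      have hprev := ih fun l hl => h l (hl.trans Fin.castSucc_lt_succ)
      have hsample : sOf f1 f2 c i = sOf f1 f2 c' i := by
        simp only [sOf, h i Fin.castSucc_lt_succ]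
      funext j
      rw [hupd, hupd, hprev, hsample]
  have hswap : ∑ c : Fin n → Bool, ∑ i : Fin n,
        rOf f1 f2 c i (d (p (sOf f1 f2 c) i.castSucc) (rOf f1 f2 c i)) =
      ∑ c : Fin n → Bool, ∑ i : Fin n,
        sOf f1 f2 c i (d (p (sOf f1 f2 c) i.castSucc) (sOf f1 f2 c i)) := by
    rw [Finset.sum_comm, Finset.sum_comm (s := Finset.univ (α := Fin n → Bool))]
    refine Finset.sum_congr rfl fun i _ => ?_
    have hinv : Function.Involutive fun c : Fin n → Bool => Function.update c i (!c i) :=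
      fun c => by simp
    refine Fintype.sum_equiv hinv.toPerm _ _ fun c => ?_
    have hval : sOf f1 f2 (Function.update c i (!c i)) i = rOf f1 f2 c i := by
      cases h : c i <;> simp [sOf, rOf, h]
    have hprice : p (sOf f1 f2 (Function.update c i (!c i))) i.castSucc
        = p (sOf f1 f2 c) i.castSucc :=
      hindep _ _ _ fun l hl => Function.update_of_ne (Fin.castSucc_lt_castSucc_iff.mp hl).ne _ _
    simp only [Function.Involutive.coe_toPerm, hval, hprice]
  have hgreedy : ∀ c, OPT (sOf f1 f2 c) ≤ 3 * ∑ i,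
      sOf f1 f2 c i (d (p (sOf f1 f2 c) i.castSucc) (sOf f1 f2 c i)) := fun c =>
    OPT_le_three_mul_greedy (fun i => hd _ _)
      (fun i => show IsSupport _ _ (asup (sOf f1 f2 c i) _) by
        unfold sOf
        split_ifs
        exacts [hsup1 i _, hsup2 i _])
      (hp0 _) (hupd c)
  have hsum := Finset.sum_le_sum fun c (_ : c ∈ Finset.univ) => hgreedy c
  rw [← Finset.mul_sum, ← hswap] at hsum
  rw [ge_iff_le, mul_left_comm]
  exact mul_le_mul_of_nonneg_left (by linarith) (by positivity)
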